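/- arXiv:alg-geom/9409008 — 5 statements merged into one kernel-verified Lean document; each statement's English description precedes it below -/
import Mathlib

section
/- Let V be a ℚ-vector space with a symmetric bilinear form B. Let s ≥ 1, and for 1 ≤ i ≤ s let rᵢ be positive rationals, aᵢ ∈ V, bᵢ ∈ ℚ. Define the partial sums Rᵢ = r₁ + ⋯ + rᵢ, Aᵢ = a₁ + ⋯ + aᵢ, and Cᵢ = Σ_{j≤i} bⱼ + Σ_{j<k≤i} B(aⱼ,aₖ). Set μ(i) = Aᵢ/Rᵢ, δᵢ = (1/rᵢ)(bᵢ − ((rᵢ−1)/(2rᵢ))·B(aᵢ,aᵢ)), and Δ = (1/R_s)(C_s − ((R_s−1)/(2R_s))·B(A_s,A_s)). Then Δ = Σ_{i=1}^{s} (rᵢ/R_s)·δᵢ − Σ_{i=2}^{s} (R_{i−1}·Rᵢ/(2·rᵢ·R_s))·B(μ(i−1)−μ(i), μ(i−1)−μ(i)). -/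
/-- The rank times the discriminant of an extension, in terms of the ranks `R, r` and the
Chern data `(A, C)`, `(a, b)` of the two pieces. -/
lemma extension_discriminant {V : Type*} [AddCommGroup V] [Module ℚ V]
    (B : V →ₗ[ℚ] V →ₗ[ℚ] ℚ) (hB : ∀ x y, B x y = B y x)
    {R r : ℚ} (hR : 0 < R) (hr : 0 < r) (A a : V) (C b : ℚ) :
    (C + b + B A a) - ((R + r - 1) / (2 * (R + r))) * B (A + a) (A + a) =
      (C - ((R - 1) / (2 * R)) * B A A) + (b - ((r - 1) / (2 * r)) * B a a)
        - (R * (R + r) / (2 * r)) *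
          B (R⁻¹ • A - (R + r)⁻¹ • (A + a)) (R⁻¹ • A - (R + r)⁻¹ • (A + a)) := by
  have hRr : R + r ≠ 0 := (add_pos hR hr).ne'
  simp only [map_add, map_sub, map_smul, LinearMap.add_apply, LinearMap.sub_apply,
    LinearMap.smul_apply, smul_eq_mul, hB a A]
  field_simp
  ring

/-- The rank times the discriminant of a filtered object. -/
lemma rank_mul_filtration_discriminant {V : Type*} [AddCommGroup V] [Module ℚ V]
    (B : V →ₗ[ℚ] V →ₗ[ℚ] ℚ) (hB : ∀ x y, B x y = B y x)
    (s : ℕ) (hs : 1 ≤ s) (r : ℕ → ℚ) (hr : ∀ i ∈ Finset.Icc 1 s, 0 < r i)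
    (a : ℕ → V) (b : ℕ → ℚ) :
    let R : ℕ → ℚ := fun i => ∑ j ∈ Finset.Icc 1 i, r j
    let A : ℕ → V := fun i => ∑ j ∈ Finset.Icc 1 i, a j
    let C : ℕ → ℚ := fun i =>
      (∑ j ∈ Finset.Icc 1 i, b j)
        + ∑ k ∈ Finset.Icc 1 i, ∑ j ∈ Finset.Icc 1 (k - 1), B (a j) (a k)
    let μ : ℕ → V := fun i => (R i)⁻¹ • A i
    C s - ((R s - 1) / (2 * R s)) * B (A s) (A s) =
      (∑ i ∈ Finset.Icc 1 s, (b i - ((r i - 1) / (2 * r i)) * B (a i) (a i)))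
        - ∑ i ∈ Finset.Icc 2 s,
            (R (i - 1) * R i / (2 * r i)) * B (μ (i - 1) - μ i) (μ (i - 1) - μ i) := by
  intro R A C μ
  induction s, hs using Nat.le_induction with
  | base => simp [R, A, C]
  | succ n hn ih =>
    have hr' : ∀ i ∈ Finset.Icc 1 n, 0 < r i := fun i hi =>
      hr i (Finset.Icc_subset_Icc_right n.le_succ hi)
    have hRn : 0 < R n := Finset.sum_pos hr' ⟨1, by simpa using hn⟩
    have hR : R (n + 1) = R n + r (n + 1) := Finset.sum_Icc_succ_top (by lia) _
    have hA : A (n + 1) = A n + a (n + 1) := Finset.sum_Icc_succ_top (by lia) _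
    have hC : C (n + 1) = C n + b (n + 1) + B (A n) (a (n + 1)) := by
      simp only [C, A, Finset.sum_Icc_succ_top (Nat.le_add_left 1 n), Nat.add_sub_cancel,
        map_sum, LinearMap.sum_apply]
      ring
    have key := extension_discriminant B hB hRn (hr (n + 1) (by simp)) (A n) (a (n + 1))
      (C n) (b (n + 1))
    rw [← hR, ← hA, ← hC, ih hr'] at key
    rw [key, Finset.sum_Icc_succ_top (by lia), Finset.sum_Icc_succ_top (by lia)]
    simp only [Nat.add_sub_cancel, μ]
    ring

/-- Equation (2.1) of the paper: the discriminant of a filtered sheaf in terms of the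
discriminants of its graded pieces and the squares of slope differences of the
partial filtration steps. Here `(r i, a i, b i)` for `1 ≤ i ≤ s` are the rank and
Chern data of the graded pieces, `R, A, C` the data of the filtration steps. -/
theorem filtration_discriminant
    (V : Type*) [AddCommGroup V] [Module ℚ V]
    (B : V →ₗ[ℚ] V →ₗ[ℚ] ℚ) (hB : ∀ x y, B x y = B y x)
    (s : ℕ) (hs : 1 ≤ s)
    (r : ℕ → ℚ) (hr : ∀ i ∈ Finset.Icc 1 s, 0 < r i)
    (a : ℕ → V) (b : ℕ → ℚ) :
    let R : ℕ → ℚ := fun i => ∑ j ∈ Finset.Icc 1 i, r j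
    let A : ℕ → V := fun i => ∑ j ∈ Finset.Icc 1 i, a j
    let C : ℕ → ℚ := fun i =>
      (∑ j ∈ Finset.Icc 1 i, b j)
        + ∑ k ∈ Finset.Icc 1 i, ∑ j ∈ Finset.Icc 1 (k - 1), B (a j) (a k)
    let μ : ℕ → V := fun i => (R i)⁻¹ • A i
    let δ : ℕ → ℚ := fun i =>
      (1 / r i) * (b i - ((r i - 1) / (2 * r i)) * B (a i) (a i))
    let Δ : ℚ := (1 / R s) * (C s - ((R s - 1) / (2 * R s)) * B (A s) (A s))
    Δ = (∑ i ∈ Finset.Icc 1 s, (r i / R s) * δ i)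
        - ∑ i ∈ Finset.Icc 2 s,
            (R (i - 1) * R i / (2 * r i * R s)) * B (μ (i - 1) - μ i) (μ (i - 1) - μ i) := by
  intro R A C μ δ Δ
  have key : C s - ((R s - 1) / (2 * R s)) * B (A s) (A s) = _ :=
    rank_mul_filtration_discriminant B hB s hs r hr a b
  simp only [Δ]
  rw [key, mul_sub, Finset.mul_sum, Finset.mul_sum]
  congr 1
  · refine Finset.sum_congr rfl fun i hi => ?_
    have hi : r i ≠ 0 := (hr i hi).ne'
    simp only [δ]
    field_simp
  · refine Finset.sum_congr rfl fun i _ => ?_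
    simp only [R, μ, A]
    ring
end

section
/- Let g ≥ 1 and e be integers with e > 2g − 2, and let Λ = ℚ² with basis C₀, f and symmetric bilinear form B determined by B(C₀,C₀) = −e, B(C₀,f) = 1, B(f,f) = 0. Set K = −2·C₀ + (2g−2−e)·f and define P(ξ) = B(ξ, ξ − K)/2 + (1−g) for ξ ∈ Λ. Let r₁, r₂, a, b be integers with r₁, r₂, a, b ≥ 1, let Δ₁, Δ₂ be rationals with Δ₁ ≥ 0 and Δ₂ ≥ 0, and set ξ = (1/(r₁r₂))·(a·C₀ − b·f). Then d := −r₁r₂·(P(ξ) − Δ₁ − Δ₂) satisfies d ≥ 3/2; consequently, if d is an integer then d ≥ 2. -/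
/-- The key codimension estimate of Section 4 of the paper: for a ruled surface over a
curve of genus `g ≥ 1` with `e > 2g − 2`, canonical class `K = −2C₀ + (2g−2−e)f` and
Riemann–Roch polynomial `P(ξ) = B(ξ, ξ−K)/2 + (1−g)`, the codimension
`d = −r₁r₂(P(ξ) − Δ₁ − Δ₂)` of a Harder–Narasimhan stratum with
`ξ = (aC₀ − bf)/(r₁r₂)`, `a, b ≥ 1`, `Δ₁, Δ₂ ≥ 0`, satisfies `d ≥ 3/2`; hence
`d ≥ 2` if `d` is an integer. Here `C₀ = (1,0)` and `f = (0,1)` in `ℚ × ℚ`. -/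
theorem codimension_at_least_two
    (g e : ℤ) (hg : 1 ≤ g) (he : 2 * g - 2 < e)
    (B : (ℚ × ℚ) →ₗ[ℚ] (ℚ × ℚ) →ₗ[ℚ] ℚ)
    (hsymm : ∀ v w, B v w = B w v)
    (hCC : B (1, 0) (1, 0) = -(e : ℚ))
    (hCf : B (1, 0) (0, 1) = 1)
    (hff : B (0, 1) (0, 1) = 0)
    (r₁ r₂ a b : ℤ) (hr₁ : 1 ≤ r₁) (hr₂ : 1 ≤ r₂) (ha : 1 ≤ a) (hb : 1 ≤ b)
    (Δ₁ Δ₂ : ℚ) (hΔ₁ : 0 ≤ Δ₁) (hΔ₂ : 0 ≤ Δ₂) :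
    let K : ℚ × ℚ := (-2 : ℚ) • (1, 0) + ((2 * g - 2 - e : ℤ) : ℚ) • (0, 1)
    let P : ℚ × ℚ → ℚ := fun ξ => B ξ (ξ - K) / 2 + (1 - (g : ℚ))
    let ξ : ℚ × ℚ := (1 / ((r₁ : ℚ) * r₂)) • ((a : ℚ) • (1, 0) - (b : ℚ) • (0, 1))
    let d : ℚ := -((r₁ : ℚ) * r₂) * (P ξ - Δ₁ - Δ₂)
    (3 : ℚ) / 2 ≤ d ∧ ∀ n : ℤ, (n : ℚ) = d → 2 ≤ n := by
  intro K P ξ d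
  have hfC : B (0, 1) (1, 0) = 1 := by rw [hsymm, hCf]
  have hg' : (1 : ℚ) ≤ g := by exact_mod_cast hg
  have he' : (1 : ℚ) ≤ e := by exact_mod_cast (by linarith : (1 : ℤ) ≤ e)
  have ha' : (1 : ℚ) ≤ a := by exact_mod_cast ha
  have hb' : (1 : ℚ) ≤ b := by exact_mod_cast hb
  have hr₁' : (1 : ℚ) ≤ r₁ := by exact_mod_cast hr₁
  have hr₂' : (1 : ℚ) ≤ r₂ := by exact_mod_cast hr₂
  have hr : (0 : ℚ) < (r₁ : ℚ) * r₂ := by positivity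
  have hd_eq : d = ((e : ℚ) * a ^ 2 + 2 * a * b) / (2 * ((r₁ : ℚ) * r₂))
      + (a * (e + 2 * (g - 1)) + 2 * b) / 2 + (r₁ * r₂) * (g - 1)
      + (r₁ * r₂) * (Δ₁ + Δ₂) := by
    simp only [d, P, ξ, K, map_sub, map_add, map_smul, LinearMap.sub_apply,
      LinearMap.smul_apply, smul_eq_mul, hCC, hCf, hfC, hff]
    push_cast
    field_simp
    ring
  have hquad : 0 ≤ ((e : ℚ) * a ^ 2 + 2 * a * b) / (2 * ((r₁ : ℚ) * r₂)) := by positivity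
  have hlin : (1 : ℚ) ≤ a * (e + 2 * (g - 1)) :=
    one_le_mul_of_one_le_of_one_le ha' (by linarith)
  have hgenus : 0 ≤ (r₁ * r₂ : ℚ) * (g - 1) := mul_nonneg hr.le (by linarith)
  have hdisc : 0 ≤ (r₁ * r₂ : ℚ) * (Δ₁ + Δ₂) := by positivity
  have hd : (3 : ℚ) / 2 ≤ d := by linarith
  refine ⟨hd, fun n hn => ?_⟩
  have hn' : (1 : ℚ) < n := by linarith
  exact_mod_cast hn'
end

section
/- Let e be an integer and let Λ = ℚ² with basis C₀, f and symmetric bilinear form B determined by B(C₀,C₀) = −e, B(C₀,f) = 1, B(f,f) = 0. Let r₁, r₂ be positive rationals, r = r₁ + r₂, let m₁, m₂, x, Δ be rationals, and suppose that B(m₁·f + C₀ − m₂·f, C₀ + x·f) ≤ 0 and Δ ≥ −(r₁r₂/(2r²))·B(C₀ + (m₁−m₂)·f, C₀ + (m₁−m₂)·f). Then x ≤ e/2 + (r²/(r₁r₂))·Δ. -/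
/-- Numerical core of the necessity direction of Proposition 3.1 of the paper: on the
lattice `Λ = ℚ·C₀ ⊕ ℚ·f` of a ruled surface, if the slope inequality
`B(m₁f + C₀ − m₂f, C₀ + xf) ≤ 0` holds and
`Δ ≥ −(r₁r₂/(2r²))·B(C₀ + (m₁−m₂)f, C₀ + (m₁−m₂)f)`, then
`x ≤ e/2 + (r²/(r₁r₂))·Δ`. Here `C₀ = (1,0)` and `f = (0,1)` in `ℚ × ℚ`. -/
theorem slope_bound_necessity
    (e : ℤ) (B : (ℚ × ℚ) →ₗ[ℚ] (ℚ × ℚ) →ₗ[ℚ] ℚ)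
    (hsymm : ∀ v w, B v w = B w v)
    (hCC : B (1, 0) (1, 0) = -(e : ℚ))
    (hCf : B (1, 0) (0, 1) = 1)
    (hff : B (0, 1) (0, 1) = 0)
    (r₁ r₂ : ℚ) (hr₁ : 0 < r₁) (hr₂ : 0 < r₂)
    (m₁ m₂ x Δ : ℚ)
    (hslope : B (m₁ • (0, 1) + (1, 0) - m₂ • (0, 1)) ((1, 0) + x • (0, 1)) ≤ 0)
    (hΔ : Δ ≥ -((r₁ * r₂) / (2 * (r₁ + r₂) ^ 2)) *
        B ((1, 0) + (m₁ - m₂) • (0, 1)) ((1, 0) + (m₁ - m₂) • (0, 1))) :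
    x ≤ (e : ℚ) / 2 + ((r₁ + r₂) ^ 2 / (r₁ * r₂)) * Δ := by
  have hfC : B (0, 1) (1, 0) = 1 := (hsymm _ _).trans hCf
  simp only [map_add, map_sub, map_smul, LinearMap.add_apply, LinearMap.sub_apply,
    LinearMap.smul_apply, smul_eq_mul, hCC, hCf, hfC, hff] at hslope hΔ
  have hp : 0 < r₁ * r₂ := mul_pos hr₁ hr₂
  have hR : 0 < (r₁ + r₂) ^ 2 := by positivity
  have hscaled := mul_le_mul_of_nonneg_left hΔ (div_pos hR hp).le
  have hcancel : (r₁ + r₂) ^ 2 / (r₁ * r₂) * (r₁ * r₂ / (2 * (r₁ + r₂) ^ 2)) = 1 / 2 := by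
    field_simp
  rw [← mul_assoc, mul_neg, hcancel] at hscaled
  linarith
end

section
/- Let g ≥ 1 and e be integers with e > 2g − 2, and let Λ = ℚ² with basis C₀, f and symmetric bilinear form B determined by B(C₀,C₀) = −e, B(C₀,f) = 1, B(f,f) = 0. Set K = −2·C₀ + (2g−2−e)·f and P(ξ) = B(ξ, ξ − K)/2 + (1−g). Let r₁, r₂ be integers with r₁, r₂ ≥ 1, let Δ₁, Δ₂ be rationals with r₁·Δ₁ > 1/2 and Δ₂ ≥ 0, and set ξ = (1/(r₁r₂))·(C₀ − f). Then −r₁r₂·(P(ξ) − Δ₁ − Δ₂) > 2; consequently, if this quantity is an integer then it is at least 3. -/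
/-- The bilinear form of a ruled surface, evaluated in the coordinates given by the minimal
section and a fibre. -/
theorem ruledSurface_form_apply {e : ℚ} (B : (ℚ × ℚ) →ₗ[ℚ] (ℚ × ℚ) →ₗ[ℚ] ℚ)
    (hsymm : ∀ v w, B v w = B w v) (hCC : B (1, 0) (1, 0) = -e)
    (hCf : B (1, 0) (0, 1) = 1) (hff : B (0, 1) (0, 1) = 0) (v w : ℚ × ℚ) :
    B v w = -e * v.1 * w.1 + v.1 * w.2 + v.2 * w.1 := by
  have hfC : B (0, 1) (1, 0) = 1 := by rw [hsymm, hCf]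
  have decomp (u : ℚ × ℚ) : u = u.1 • ((1, 0) : ℚ × ℚ) + u.2 • ((0, 1) : ℚ × ℚ) := by
    ext <;> simp
  rw [decomp v, decomp w]
  simp only [map_add, map_smul, LinearMap.add_apply, LinearMap.smul_apply, hCC, hCf, hff, hfC]
  simp
  ring

/-- Remark 3.4 of the paper, case `a = b = 1`: on the lattice `Λ = ℚ·C₀ ⊕ ℚ·f` of a
ruled surface over a curve of genus `g ≥ 1` with `e > 2g − 2`, with canonical class
`K = −2C₀ + (2g−2−e)f` and `P(ξ) = B(ξ, ξ−K)/2 + (1−g)`, if `r₁Δ₁ > 1/2` and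
`Δ₂ ≥ 0` then for `ξ = (C₀ − f)/(r₁r₂)` the codimension `−r₁r₂(P(ξ) − Δ₁ − Δ₂)`
exceeds `2`, hence is at least `3` when it is an integer.
Here `C₀ = (1,0)` and `f = (0,1)` in `ℚ × ℚ`. -/
theorem codimension_at_least_three
    (g e : ℤ) (hg : 1 ≤ g) (he : 2 * g - 2 < e)
    (B : (ℚ × ℚ) →ₗ[ℚ] (ℚ × ℚ) →ₗ[ℚ] ℚ)
    (hsymm : ∀ v w, B v w = B w v)
    (hCC : B (1, 0) (1, 0) = -(e : ℚ))
    (hCf : B (1, 0) (0, 1) = 1)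
    (hff : B (0, 1) (0, 1) = 0)
    (r₁ r₂ : ℤ) (hr₁ : 1 ≤ r₁) (hr₂ : 1 ≤ r₂)
    (Δ₁ Δ₂ : ℚ) (hΔ₁ : (1 : ℚ) / 2 < (r₁ : ℚ) * Δ₁) (hΔ₂ : 0 ≤ Δ₂) :
    let K : ℚ × ℚ := (-2 : ℚ) • (1, 0) + ((2 * g - 2 - e : ℤ) : ℚ) • (0, 1)
    let P : ℚ × ℚ → ℚ := fun ξ => B ξ (ξ - K) / 2 + (1 - (g : ℚ))
    let ξ : ℚ × ℚ := (1 / ((r₁ : ℚ) * r₂)) • ((1, 0) - (0, 1) : ℚ × ℚ)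
    (2 : ℚ) < -((r₁ : ℚ) * r₂) * (P ξ - Δ₁ - Δ₂) ∧
    ∀ n : ℤ, (n : ℚ) = -((r₁ : ℚ) * r₂) * (P ξ - Δ₁ - Δ₂) → 3 ≤ n := by
  intro K P ξ
  have hr₁' : (1 : ℚ) ≤ r₁ := by exact_mod_cast hr₁
  have hr₂' : (1 : ℚ) ≤ r₂ := by exact_mod_cast hr₂
  have hg' : (1 : ℚ) ≤ g := by exact_mod_cast hg
  have he' : 2 * (g : ℚ) - 1 ≤ e := by
    have : 2 * g - 1 ≤ e := by omega
    exact_mod_cast this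
  have hs : (0 : ℚ) < r₁ * r₂ := by positivity
  have codim_eq : -((r₁ : ℚ) * r₂) * (P ξ - Δ₁ - Δ₂) =
      (e + 2) / (r₁ * r₂) / 2 + (e + 2 * g) / 2 + r₁ * r₂ * (g - 1) +
        r₂ * (r₁ * Δ₁) + r₁ * r₂ * Δ₂ := by
    simp only [P, K, ξ, ruledSurface_form_apply B hsymm hCC hCf hff]
    simp
    field_simp
    ring
  have codim_gt : (2 : ℚ) < -((r₁ : ℚ) * r₂) * (P ξ - Δ₁ - Δ₂) := by
    have hpos : 0 < ((e : ℚ) + 2) / (r₁ * r₂) := div_pos (by linarith) hs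
    have hgenus : 0 ≤ (r₁ : ℚ) * r₂ * (g - 1) := mul_nonneg hs.le (by linarith)
    have hdisc₁ : 1 / 2 < (r₂ : ℚ) * (r₁ * Δ₁) := by nlinarith
    have hdisc₂ : 0 ≤ (r₁ : ℚ) * r₂ * Δ₂ := mul_nonneg hs.le hΔ₂
    linarith
  refine ⟨codim_gt, fun n hn => ?_⟩
  rw [← hn] at codim_gt
  exact_mod_cast codim_gt
end

section
/- Let χ, d₁, d₂, e, r₂ be integers with (r₂−1)·d₂ ≠ 0. Define the ℤ-linear map φ: ℤ⁴ → ℤ³ on the standard basis e₁, e₂, e₃, e₄ by φ(e₁) = −(2χ+2d₁−e, χ+d₂, r₂χ+d₂), φ(e₂) = −(2χ+2d₁−2−e, χ+d₂−1, r₂χ+d₂−r₂), φ(e₃) = −(χ+d₁, 0, 0), φ(e₄) = −(χ+d₁−1, 0, 0). Then the kernel of φ is the subgroup of ℤ⁴ generated by (χ+d₁−1)·e₃ − (χ+d₁)·e₄, and the cokernel ℤ³/φ(ℤ⁴) is cyclic of order |(r₂−1)·d₂|, i.e. isomorphic to ℤ/(r₂−1)d₂ℤ. -/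
/-- The linear form `v ↦ v₂ - r v₁` on `ℤ³`, reduced modulo `n`. -/
def lastSubMulModHom (r : ℤ) (n : ℕ) : (Fin 3 → ℤ) →ₗ[ℤ] ZMod n :=
  (Int.castAddHom (ZMod n)).toIntLinearMap ∘ₗ
    (LinearMap.proj 2 - r • LinearMap.proj 1 : (Fin 3 → ℤ) →ₗ[ℤ] ℤ)

theorem lastSubMulModHom_apply (r : ℤ) (n : ℕ) (v : Fin 3 → ℤ) :
    lastSubMulModHom r n v = ((v 2 - r * v 1 : ℤ) : ZMod n) := rfl

theorem lastSubMulModHom_surjective (r : ℤ) (n : ℕ) :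
    Function.Surjective (lastSubMulModHom r n) := by
  intro x
  obtain ⟨k, rfl⟩ := ZMod.intCast_surjective x
  exact ⟨![0, 0, k], by simp [lastSubMulModHom_apply]⟩

theorem lastSubMulModHom_eq_zero_iff (r m : ℤ) (v : Fin 3 → ℤ) :
    lastSubMulModHom r m.natAbs v = 0 ↔ m ∣ v 2 - r * v 1 := by
  rw [lastSubMulModHom_apply, ZMod.intCast_zmod_eq_zero_iff_dvd, Int.natAbs_dvd]

/-- The lattice computation in the proof of Lemma 4.1 of the paper: for the
ℤ-linear map `φ : ℤ⁴ → ℤ³` with the indicated columns, the kernel is generated by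
`(χ+d₁−1)e₃ − (χ+d₁)e₄` and the cokernel is cyclic of order `|(r₂−1)d₂|`. -/
theorem picard_lattice_computation
    (χ d₁ d₂ e r₂ : ℤ) (h : (r₂ - 1) * d₂ ≠ 0) :
    let φ : (Fin 4 → ℤ) →ₗ[ℤ] (Fin 3 → ℤ) :=
      Matrix.toLin'
        (!![-(2 * χ + 2 * d₁ - e), -(2 * χ + 2 * d₁ - 2 - e), -(χ + d₁), -(χ + d₁ - 1);
            -(χ + d₂),             -(χ + d₂ - 1),             0,          0;
            -(r₂ * χ + d₂),        -(r₂ * χ + d₂ - r₂),       0,          0] :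
          Matrix (Fin 3) (Fin 4) ℤ)
    (∀ v : Fin 4 → ℤ, φ v = 0 ↔
        ∃ n : ℤ, v = n • ((χ + d₁ - 1) • (Pi.single 2 1 : Fin 4 → ℤ)
                            - (χ + d₁) • (Pi.single 3 1 : Fin 4 → ℤ))) ∧
    Nonempty (((Fin 3 → ℤ) ⧸ LinearMap.range φ) ≃+ ZMod ((r₂ - 1) * d₂).natAbs) := by
  intro φ
  have apply_eq (v : Fin 4 → ℤ) : φ v =
      ![-(2 * χ + 2 * d₁ - e) * v 0 - (2 * χ + 2 * d₁ - 2 - e) * v 1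
          - (χ + d₁) * v 2 - (χ + d₁ - 1) * v 3,
        -(χ + d₂) * v 0 - (χ + d₂ - 1) * v 1,
        -(r₂ * χ + d₂) * v 0 - (r₂ * χ + d₂ - r₂) * v 1] := by
    ext i
    fin_cases i <;> simp [φ, Matrix.mulVec, dotProduct, Fin.sum_univ_four] <;> ring
  refine ⟨fun v => ⟨fun hv => ?_, ?_⟩, ?_⟩
  · rw [apply_eq] at hv
    have hx := congrFun hv 0
    have hy := congrFun hv 1
    have hz := congrFun hv 2
    simp only [Matrix.cons_val, Pi.zero_apply] at hx hy hz
    have hs : v 0 + v 1 = 0 := by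
      refine (mul_eq_zero.mp ?_).resolve_left h
      linear_combination hz - r₂ * hy
    have h1 : v 1 = 0 := by linear_combination hy + (χ + d₂) * hs
    have h0 : v 0 = 0 := by linear_combination hs - h1
    rw [h0, h1] at hx
    refine ⟨-(v 2 + v 3), ?_⟩
    ext i
    fin_cases i <;> simp [h0, h1]
    · linear_combination -hx
    · linear_combination hx
  · rintro ⟨n, rfl⟩
    rw [apply_eq]
    ext i
    fin_cases i <;> simp
    ring
  · have range_eq : LinearMap.range φ =
        LinearMap.ker (lastSubMulModHom r₂ ((r₂ - 1) * d₂).natAbs) := by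
      ext w
      rw [LinearMap.mem_ker, lastSubMulModHom_eq_zero_iff]
      constructor
      · rintro ⟨v, rfl⟩
        refine ⟨v 0 + v 1, ?_⟩
        simp only [apply_eq, Matrix.cons_val]
        ring
      · rintro ⟨k, hk⟩
        let b := w 1 + k * (χ + d₂)
        let t := w 0 + (2 * χ + 2 * d₁ - e) * (k - b) + (2 * χ + 2 * d₁ - 2 - e) * b
        refine ⟨![k - b, b, -t, t], ?_⟩
        rw [apply_eq]
        ext i
        fin_cases i <;> simp only [Fin.zero_eta, Fin.mk_one, Fin.reduceFinMk, Matrix.cons_val, t, b]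
        · ring
        · ring
        · linear_combination -hk
    exact ⟨((Submodule.quotEquivOfEq _ _ range_eq).trans
      (LinearMap.quotKerEquivOfSurjective _ (lastSubMulModHom_surjective _ _))).toAddEquiv⟩
end
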